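/- Let μ ∈ N be nonzero. Then tr((Ric^{c}_μ)²)/‖μ‖⁴ ≤ tr((Ric^{c}_{g.μ})²)/‖g.μ‖⁴ for every g ∈ GL(n,ℂ) if and only if there exist c ∈ ℝ and D ∈ Der(μ) such that Ric^{c}_μ = c·I + D. (A compatible metric on an (almost-)complex nilpotent Lie group is minimal if and only if the complexified Ricci operator equals cI + D with D a derivation.) -/

import Mathlib

open scoped BigOperators
open Matrix

noncomputable section

/-- vectors in `ℝ^m`. -/
abbrev Vec (m : ℕ) := Fin m → ℝ

/-- bilinear-map candidates `ℝ^m × ℝ^m → ℝ^m`. -/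
abbrev Bil (m : ℕ) := Vec m → Vec m → Vec m

/-- the `i`-th standard basis vector of `ℝ^m`. -/
def bvec (m : ℕ) (i : Fin m) : Vec m := Pi.single i 1

/-- `μ` is a skew-symmetric bilinear map, i.e. an element of `V = Λ²(ℝ^m)* ⊗ ℝ^m`. -/
def IsSkewBil {m : ℕ} (μ : Bil m) : Prop :=
  (∀ Y, IsLinearMap ℝ fun X => μ X Y) ∧ (∀ X, IsLinearMap ℝ (μ X)) ∧ ∀ X Y, μ X Y = -μ Y X

/-- the Jacobi identity for `μ`. -/
def IsJacobi {m : ℕ} (μ : Bil m) : Prop :=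
  ∀ X Y Z, μ (μ X Y) Z + μ (μ Y Z) X + μ (μ Z X) Y = 0

/-- iterated left multiplications `μ(X (k-1), ⋯ μ(X 0, Y))`. -/
def adPow {m : ℕ} (μ : Bil m) (X : ℕ → Vec m) : ℕ → Vec m → Vec m
  | 0, Y => Y
  | k + 1, Y => μ (X k) (adPow μ X k Y)

/-- nilpotency of the bracket `μ`. -/
def IsNilpotentBil {m : ℕ} (μ : Bil m) : Prop :=
  ∃ k : ℕ, ∀ (X : ℕ → Vec m) (Y : Vec m), adPow μ X k Y = 0

/-- membership in the variety `N` of nilpotent Lie brackets on `ℝ^m`. -/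
def NilBracket {m : ℕ} (μ : Bil m) : Prop :=
  IsSkewBil μ ∧ IsJacobi μ ∧ IsNilpotentBil μ

/-- the `GL_m(ℝ)` action `(g.μ)(X,Y) = g μ(g⁻¹X, g⁻¹Y)` on `V`. -/
def mact {m : ℕ} (g : Matrix (Fin m) (Fin m) ℝ) (μ : Bil m) : Bil m :=
  fun X Y => g.mulVec (μ (g⁻¹.mulVec X) (g⁻¹.mulVec Y))

/-- `‖μ‖²` for the natural inner product on `V`. -/
def normSqV {m : ℕ} (μ : Bil m) : ℝ :=
  ∑ i, ∑ j, ∑ k, (μ (bvec m i) (bvec m j) k) ^ 2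

/-- the Ricci operator of `(N_μ, ⟨·,·⟩)`, as a matrix:
`⟨Ric_μ X, Y⟩ = -(1/2) Σ ⟨μ(X,Xᵢ),Xⱼ⟩⟨μ(Y,Xᵢ),Xⱼ⟩ + (1/4) Σ ⟨μ(Xᵢ,Xⱼ),X⟩⟨μ(Xᵢ,Xⱼ),Y⟩`. -/
def RicM {m : ℕ} (μ : Bil m) : Matrix (Fin m) (Fin m) ℝ :=
  Matrix.of fun x y =>
    -(1/2) * (∑ i, ∑ j, μ (bvec m x) (bvec m i) j * μ (bvec m y) (bvec m i) j)
    + (1/4) * (∑ i, ∑ j, μ (bvec m i) (bvec m j) x * μ (bvec m i) (bvec m j) y)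

/-- `D` is a derivation of the bracket `μ`. -/
def IsDerivation {m : ℕ} (μ : Bil m) (D : Matrix (Fin m) (Fin m) ℝ) : Prop :=
  ∀ X Y, D.mulVec (μ X Y) = μ (D.mulVec X) Y + μ X (D.mulVec Y)

/-- the matrix of `ad_μ X : Y ↦ μ(X,Y)`. -/
def adMat {m : ℕ} (μ : Bil m) (X : Vec m) : Matrix (Fin m) (Fin m) ℝ :=
  Matrix.of fun j i => μ X (bvec m i) j

/-- the moment-map value `M_μ = -4 Σᵢ (ad_μ Xᵢ)ᵗ(ad_μ Xᵢ) + 2 Σᵢ (ad_μ Xᵢ)(ad_μ Xᵢ)ᵗ`. -/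
def Mmat {m : ℕ} (μ : Bil m) : Matrix (Fin m) (Fin m) ℝ :=
  (-4 : ℝ) • (∑ i, (adMat μ (bvec m i))ᵀ * adMat μ (bvec m i))
    + (2 : ℝ) • (∑ i, adMat μ (bvec m i) * (adMat μ (bvec m i))ᵀ)

/-- the 2-form `ω(X,Y) = ⟨X, JY⟩`. -/
def sympForm {m : ℕ} (J : Matrix (Fin m) (Fin m) ℝ) (X Y : Vec m) : ℝ :=
  X ⬝ᵥ J.mulVec Y

/-- closedness of a 2-form `ω` with respect to the bracket `μ`:
`ω(μ(X,Y),Z) + ω(μ(Y,Z),X) + ω(μ(Z,X),Y) = 0`. -/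
def IsClosedForm {m : ℕ} (ω : Vec m → Vec m → ℝ) (μ : Bil m) : Prop :=
  ∀ X Y Z, ω (μ X Y) Z + ω (μ Y Z) X + ω (μ Z X) Y = 0

/-- membership in `Sp(n,ℝ)`: invertible and preserving `ω = ⟨·, J·⟩`. -/
def IsSymplMat {m : ℕ} (J g : Matrix (Fin m) (Fin m) ℝ) : Prop :=
  IsUnit g ∧ ∀ X Y, sympForm J (g.mulVec X) (g.mulVec Y) = sympForm J X Y

/-- membership in `GL(n,ℂ) = {g : gJ = Jg}`. -/
def IsCxMat {m : ℕ} (J g : Matrix (Fin m) (Fin m) ℝ) : Prop :=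
  IsUnit g ∧ g * J = J * g

/-- the anti-complexified Ricci operator `Ric^{ac} = (1/2)(Ric + J Ric J)`. -/
def Ricac {m : ℕ} (J : Matrix (Fin m) (Fin m) ℝ) (μ : Bil m) : Matrix (Fin m) (Fin m) ℝ :=
  (1/2 : ℝ) • (RicM μ + J * RicM μ * J)

/-- the complexified Ricci operator `Ric^{c} = (1/2)(Ric − J Ric J)`. -/
def Ricc {m : ℕ} (J : Matrix (Fin m) (Fin m) ℝ) (μ : Bil m) : Matrix (Fin m) (Fin m) ℝ :=
  (1/2 : ℝ) • (RicM μ - J * RicM μ * J)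

section helpers

variable {m : ℕ}

theorem bil_expand {μ : Bil m} (h : IsSkewBil μ) (X Y : Vec m) :
    μ X Y = ∑ i, ∑ j, (X i * Y j) • μ (bvec m i) (bvec m j) := by
  obtain ⟨h1, h2, -⟩ := h
  have hX : ∀ X : Vec m, X = ∑ i, X i • bvec m i := by
    intro X
    simpa [bvec] using (pi_eq_sum_univ' X)
  have e1 : ∀ Y, μ X Y = ∑ i, X i • μ (bvec m i) Y := by
    intro Y
    have := congrArg (fun Z => (h1 Y).mk' _ Z) (hX X)
    simpa [map_sum, IsLinearMap.mk'_apply] using this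
  have e2 : ∀ Z, μ Z Y = ∑ j, Y j • μ Z (bvec m j) := by
    intro Z
    have := congrArg (fun W => (h2 Z).mk' _ W) (hX Y)
    simpa [map_sum, IsLinearMap.mk'_apply] using this
  rw [e1]
  refine Finset.sum_congr rfl fun i _ => ?_
  rw [e2, Finset.smul_sum]
  exact Finset.sum_congr rfl fun j _ => by rw [smul_smul]

theorem mact_mul (g h : Matrix (Fin m) (Fin m) ℝ) (μ : Bil m) :
    mact (g * h) μ = mact g (mact h μ) := by
  funext X Y
  simp [mact, Matrix.mul_inv_rev, Matrix.mulVec_mulVec]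

theorem mact_one (μ : Bil m) : mact 1 μ = μ := by
  funext X Y
  simp [mact]

theorem mact_skew {μ : Bil m} (h : IsSkewBil μ) (g : Matrix (Fin m) (Fin m) ℝ) :
    IsSkewBil (mact g μ) := by
  obtain ⟨h1, h2, h3⟩ := h
  refine ⟨fun Y => ⟨fun X X' => ?_, fun c X => ?_⟩, fun X => ⟨fun Y Y' => ?_, fun c Y => ?_⟩,
    fun X Y => ?_⟩
  · simp only [mact, Matrix.mulVec_add]
    rw [(h1 _).map_add, Matrix.mulVec_add]
  · simp only [mact, Matrix.mulVec_smul]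
    rw [(h1 _).map_smul, Matrix.mulVec_smul]
  · simp only [mact, Matrix.mulVec_add]
    rw [(h2 _).map_add, Matrix.mulVec_add]
  · simp only [mact, Matrix.mulVec_smul]
    rw [(h2 _).map_smul, Matrix.mulVec_smul]
  · simp only [mact]
    rw [h3, Matrix.mulVec_neg]

theorem mulVec_bvec (A : Matrix (Fin m) (Fin m) ℝ) (i k : Fin m) :
    A.mulVec (bvec m i) k = A k i := by
  simp [bvec]

theorem mact_coord {μ : Bil m} (h : IsSkewBil μ) (g : Matrix (Fin m) (Fin m) ℝ) (i j k : Fin m) :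
    mact g μ (bvec m i) (bvec m j) k
      = ∑ p, ∑ q, ∑ r, g k p * (g⁻¹ q i * g⁻¹ r j * μ (bvec m q) (bvec m r) p) := by
  simp only [mact]
  rw [bil_expand h]
  simp only [Matrix.mulVec, dotProduct, Finset.sum_apply, Pi.smul_apply, smul_eq_mul,
    Finset.mul_sum]
  simp [bvec, Pi.single_apply]

theorem adMat_mact {μ : Bil m} (h : IsSkewBil μ) (g : Matrix (Fin m) (Fin m) ℝ) (X : Vec m) :
    adMat (mact g μ) X = g * adMat μ (g⁻¹.mulVec X) * g⁻¹ := by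
  ext j i
  have : ∀ Y, μ (g⁻¹.mulVec X) Y = (adMat μ (g⁻¹.mulVec X)).mulVec Y := by
    intro Y
    have hY : Y = ∑ i, Y i • bvec m i := by simpa [bvec] using (pi_eq_sum_univ' Y)
    have := congrArg (fun W => (h.2.1 (g⁻¹.mulVec X)).mk' _ W) hY
    simp only [map_sum, IsLinearMap.mk'_apply, map_smul] at this
    rw [this]
    ext k
    simp [adMat, Matrix.mulVec, dotProduct, mul_comm]
  calc adMat (mact g μ) X j i = (g * adMat μ (g⁻¹.mulVec X) * g⁻¹).mulVec (bvec m i) j := by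
        change (g.mulVec (μ (g⁻¹.mulVec X) (g⁻¹.mulVec (bvec m i)))) j = _
        rw [this, ← Matrix.mulVec_mulVec, ← Matrix.mulVec_mulVec]
    _ = _ := mulVec_bvec _ _ _

theorem adMat_lin {μ : Bil m} (h : IsSkewBil μ) (X : Vec m) :
    adMat μ X = ∑ i, X i • adMat μ (bvec m i) := by
  ext j k
  have hX : X = ∑ i, X i • bvec m i := by simpa [bvec] using (pi_eq_sum_univ' X)
  have := congrArg (fun W => (h.1 (bvec m k)).mk' _ W) hX
  simp only [map_sum, IsLinearMap.mk'_apply, map_smul] at this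
  simp only [adMat, Matrix.of_apply]
  rw [this]
  simp [Matrix.sum_apply]

theorem RicM_eq {μ : Bil m} (h : IsSkewBil μ) : RicM μ =
    (-(1/2) : ℝ) • (∑ i, (adMat μ (bvec m i))ᵀ * adMat μ (bvec m i))
    + (1/4 : ℝ) • (∑ i, adMat μ (bvec m i) * (adMat μ (bvec m i))ᵀ) := by
  ext x y
  simp only [RicM, Matrix.of_apply, Matrix.add_apply, Matrix.smul_apply, Matrix.sum_apply,
    Matrix.mul_apply, Matrix.transpose_apply, adMat, smul_eq_mul]
  congr 2
  refine Finset.sum_congr rfl fun i _ => Finset.sum_congr rfl fun j _ => ?_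
  rw [h.2.2 (bvec m x), h.2.2 (bvec m y)]
  simp

theorem RicM_symm (μ : Bil m) : (RicM μ)ᵀ = RicM μ := by
  ext x y
  simp only [RicM, Matrix.of_apply, Matrix.transpose_apply]
  congr 2 <;>
  exact Finset.sum_congr rfl fun i _ => Finset.sum_congr rfl fun j _ => mul_comm _ _


theorem RicM_mact {μ : Bil m} (h : IsSkewBil μ) {Q : Matrix (Fin m) (Fin m) ℝ}
    (hQ : Qᵀ * Q = 1) : RicM (mact Q μ) = Q * RicM μ * Qᵀ := by
  have hinv : Q⁻¹ = Qᵀ := Matrix.inv_eq_left_inv hQ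
  have hQ' : Q * Qᵀ = 1 := mul_eq_one_comm.mp hQ
  have had : ∀ i, adMat (mact Q μ) (bvec m i)
      = Q * (∑ p, Q i p • adMat μ (bvec m p)) * Qᵀ := by
    intro i
    rw [adMat_mact h, hinv, adMat_lin h]
    simp only [mulVec_bvec, Matrix.transpose_apply]
  have horth : ∀ p q, ∑ i, Q i p * Q i q = if p = q then 1 else 0 := by
    intro p q
    have := congrFun (congrFun hQ p) q
    simpa [Matrix.mul_apply, Matrix.one_apply] using this
  have key : ∀ (A B : Fin m → Matrix (Fin m) (Fin m) ℝ),
      ∑ i, (∑ p, Q i p • A p) * (∑ q, Q i q • B q) = ∑ p, A p * B p := by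
    intro A B
    simp only [Finset.sum_mul_sum, smul_mul_smul_comm]
    rw [Finset.sum_comm]
    refine Finset.sum_congr rfl fun p _ => ?_
    rw [Finset.sum_comm]
    simp only [← Finset.sum_smul, horth]
    simp
  rw [RicM_eq (mact_skew h Q), RicM_eq h]
  have e1 : ∀ i, (adMat (mact Q μ) (bvec m i))ᵀ * adMat (mact Q μ) (bvec m i)
      = Q * ((∑ p, Q i p • (adMat μ (bvec m p))ᵀ) * (∑ q, Q i q • adMat μ (bvec m q))) * Qᵀ := by
    intro i
    rw [had]
    simp only [Matrix.transpose_mul, Matrix.transpose_transpose, Matrix.transpose_sum,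
      Matrix.transpose_smul]
    simp only [Matrix.mul_assoc]
    rw [← Matrix.mul_assoc Qᵀ Q, hQ, Matrix.one_mul]
  have e2 : ∀ i, adMat (mact Q μ) (bvec m i) * (adMat (mact Q μ) (bvec m i))ᵀ
      = Q * ((∑ p, Q i p • (adMat μ (bvec m p))) * (∑ q, Q i q • (adMat μ (bvec m q))ᵀ)) * Qᵀ := by
    intro i
    rw [had]
    simp only [Matrix.transpose_mul, Matrix.transpose_transpose, Matrix.transpose_sum,
      Matrix.transpose_smul]
    simp only [Matrix.mul_assoc]
    rw [← Matrix.mul_assoc Qᵀ Q, hQ, Matrix.one_mul]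
  simp only [e1, e2]
  rw [← Finset.sum_mul, ← Finset.sum_mul, ← Finset.mul_sum, ← Finset.mul_sum, key, key]
  simp only [Matrix.mul_add, Matrix.add_mul, Matrix.mul_smul, Matrix.smul_mul]

/-- pairing of the Ricci operator with a diagonal matrix -/
theorem trace_RicM_diag {μ : Bil m} (h : IsSkewBil μ) (a : Fin m → ℝ) :
    Matrix.trace (RicM μ * Matrix.diagonal a)
      = 1/4 * ∑ i, ∑ j, ∑ k, (a k - a i - a j) * (μ (bvec m i) (bvec m j) k) ^ 2 := by
  have hs : ∀ i j k, (μ (bvec m i) (bvec m j) k) ^ 2 = (μ (bvec m j) (bvec m i) k) ^ 2 := by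
    intro i j k
    rw [h.2.2 (bvec m i)]
    simp
  simp only [Matrix.trace, Matrix.diag_apply, Matrix.mul_diagonal, RicM, Matrix.of_apply,
    ← pow_two]
  have e1 : ∑ i, ∑ j, ∑ k, (a k - a i - a j) * (μ (bvec m i) (bvec m j) k) ^ 2
    = ∑ i, ∑ j, ∑ k, a k * (μ (bvec m i) (bvec m j) k) ^ 2
      - 2 * ∑ i, ∑ j, ∑ k, a i * (μ (bvec m i) (bvec m j) k) ^ 2 := by
    have e2 : ∑ i, ∑ j, ∑ k, a j * (μ (bvec m i) (bvec m j) k) ^ 2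
      = ∑ i, ∑ j, ∑ k, a i * (μ (bvec m i) (bvec m j) k) ^ 2 := by
      rw [Finset.sum_comm]
      simp only [hs]
    simp only [sub_mul, Finset.sum_sub_distrib]
    rw [e2]
    ring
  have e3 : ∑ i, ∑ j, ∑ k, a k * (μ (bvec m i) (bvec m j) k) ^ 2
    = ∑ k, (∑ i, ∑ j, (μ (bvec m i) (bvec m j) k) ^ 2) * a k := by
    simp only [Finset.sum_mul]
    rw [Finset.sum_comm' (t' := Finset.univ) (s' := fun _ => Finset.univ) (by simp)]
    have : ∀ j, ∑ i, ∑ k, a k * (μ (bvec m i) (bvec m j) k) ^ 2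
        = ∑ k, ∑ i, a k * (μ (bvec m i) (bvec m j) k) ^ 2 := fun j => Finset.sum_comm
    simp only [this]
    rw [Finset.sum_comm]
    refine Finset.sum_congr rfl fun k _ => ?_
    rw [Finset.sum_comm]
    simp only [mul_comm]
  have e4 : ∑ i, ∑ j, ∑ k, a i * (μ (bvec m i) (bvec m j) k) ^ 2
    = ∑ i, (∑ j, ∑ k, (μ (bvec m i) (bvec m j) k) ^ 2) * a i := by
    simp only [Finset.sum_mul]
    simp only [mul_comm]
  rw [e1, e3, e4, mul_sub, Finset.mul_sum, Finset.mul_sum, Finset.mul_sum,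
    ← Finset.sum_sub_distrib]
  refine Finset.sum_congr rfl fun k _ => ?_
  ring

theorem normSqV_eq {μ : Bil m} (h : IsSkewBil μ) :
    normSqV μ = -4 * Matrix.trace (RicM μ) := by
  have := trace_RicM_diag h (fun _ => 1)
  rw [Matrix.diagonal_one, Matrix.mul_one] at this
  rw [this]
  simp [normSqV]

theorem normSqV_mact {μ : Bil m} (h : IsSkewBil μ) {Q : Matrix (Fin m) (Fin m) ℝ}
    (hQ : Qᵀ * Q = 1) : normSqV (mact Q μ) = normSqV μ := by
  rw [normSqV_eq h, normSqV_eq (mact_skew h Q), RicM_mact h hQ, Matrix.mul_assoc,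
    Matrix.trace_mul_comm, Matrix.mul_assoc, hQ, Matrix.mul_one]

theorem normSqV_pos {μ : Bil m} (h : IsSkewBil μ) (h0 : μ ≠ 0) : 0 < normSqV μ := by
  have hnn : 0 ≤ normSqV μ := by unfold normSqV; positivity
  refine lt_of_le_of_ne hnn fun he => h0 ?_
  have hz : ∀ i j, μ (bvec m i) (bvec m j) = 0 := by
    intro i j
    unfold normSqV at he
    have h1 := (Finset.sum_eq_zero_iff_of_nonneg (fun i _ => by positivity)).mp he.symm i
      (Finset.mem_univ _)
    have h2 := (Finset.sum_eq_zero_iff_of_nonneg (fun i _ => by positivity)).mp h1 j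
      (Finset.mem_univ _)
    funext k
    have h3 := (Finset.sum_eq_zero_iff_of_nonneg (fun i _ => by positivity)).mp h2 k
      (Finset.mem_univ _)
    simpa using h3
  funext X Y
  rw [bil_expand h]
  simp [hz]

theorem mact_ne_zero {μ : Bil m} (h0 : μ ≠ 0) {g : Matrix (Fin m) (Fin m) ℝ}
    (hg : IsUnit g) : mact g μ ≠ 0 := by
  intro he
  apply h0
  have hd : IsUnit g.det := (Matrix.isUnit_iff_isUnit_det g).mp hg
  rw [← mact_one μ, ← Matrix.nonsing_inv_mul g hd, mact_mul, he]
  funext X Y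
  simp [mact]

theorem Ricc_mact {μ : Bil m} (h : IsSkewBil μ) (J : Matrix (Fin m) (Fin m) ℝ)
    {Q : Matrix (Fin m) (Fin m) ℝ}
    (hQ : Qᵀ * Q = 1) : Ricc J (mact Q μ) = Q * Ricc (Qᵀ * J * Q) μ * Qᵀ := by
  have hQ' : Q * Qᵀ = 1 := mul_eq_one_comm.mp hQ
  have : J * (Q * RicM μ * Qᵀ) * J = Q * (Qᵀ * J * Q * RicM μ * (Qᵀ * J * Q)) * Qᵀ := by
    simp only [Matrix.mul_assoc]
    rw [hQ', Matrix.mul_one, ← Matrix.mul_assoc Q Qᵀ, hQ', Matrix.one_mul]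
  simp only [Ricc, RicM_mact h hQ, this, Matrix.mul_sub, Matrix.sub_mul, Matrix.mul_smul,
    Matrix.smul_mul]

theorem trace_Ricc_mul (μ : Bil m) {J B : Matrix (Fin m) (Fin m) ℝ} (hJsq : J * J = -1)
    (hB : B * J = J * B) : Matrix.trace (Ricc J μ * B) = Matrix.trace (RicM μ * B) := by
  have : Matrix.trace (J * RicM μ * J * B) = - Matrix.trace (RicM μ * B) := by
    rw [Matrix.mul_assoc, ← hB, Matrix.mul_assoc, Matrix.trace_mul_comm]
    rw [Matrix.mul_assoc, Matrix.mul_assoc, hJsq]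
    simp
  rw [Ricc, Matrix.smul_mul, Matrix.sub_mul, Matrix.trace_smul, Matrix.trace_sub, this]
  simp only [smul_eq_mul]
  ring

theorem Ricc_symm (μ : Bil m) {J : Matrix (Fin m) (Fin m) ℝ} (hJ : Jᵀ = -J) :
    (Ricc J μ)ᵀ = Ricc J μ := by
  simp [Ricc, Matrix.transpose_mul, hJ, RicM_symm, Matrix.mul_assoc]

theorem Ricc_comm (μ : Bil m) {J : Matrix (Fin m) (Fin m) ℝ} (hJsq : J * J = -1) :
    Ricc J μ * J = J * Ricc J μ := by
  simp only [Ricc, Matrix.smul_mul, Matrix.mul_smul, Matrix.sub_mul, Matrix.mul_sub]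
  congr 1
  have e1 : J * RicM μ * J * J = -(J * RicM μ) := by
    rw [Matrix.mul_assoc, hJsq]; simp
  have e2 : J * (J * RicM μ * J) = -(RicM μ * J) := by
    rw [← Matrix.mul_assoc, ← Matrix.mul_assoc, hJsq]; simp
  rw [e1, e2]
  abel

theorem trace_mul_eq_sum {X Y : Matrix (Fin m) (Fin m) ℝ} (hY : Yᵀ = Y) :
    Matrix.trace (X * Y) = ∑ p : Fin m × Fin m, X p.1 p.2 * Y p.1 p.2 := by
  rw [Fintype.sum_prod_type]
  simp only [Matrix.trace, Matrix.diag_apply, Matrix.mul_apply]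
  refine Finset.sum_congr rfl fun i _ => Finset.sum_congr rfl fun j _ => ?_
  rw [← congrFun (congrFun hY j) i, Matrix.transpose_apply]

theorem trace_cs {X Y : Matrix (Fin m) (Fin m) ℝ} (hX : Xᵀ = X) (hY : Yᵀ = Y) :
    (Matrix.trace (X * Y)) ^ 2 ≤ Matrix.trace (X * X) * Matrix.trace (Y * Y) := by
  rw [trace_mul_eq_sum hY, trace_mul_eq_sum hX, trace_mul_eq_sum hY]
  simpa only [pow_two] using Finset.sum_mul_sq_le_sq_mul_sq Finset.univ
    (fun p : Fin m × Fin m => X p.1 p.2) (fun p => Y p.1 p.2)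

theorem exists_qr (g : Matrix (Fin m) (Fin m) ℝ) : ∃ Q : Matrix (Fin m) (Fin m) ℝ,
    Qᵀ * Q = 1 ∧ ∀ i j, j < i → (Qᵀ * g) i j = 0 := by
  let f : Fin m → EuclideanSpace ℝ (Fin m) := fun j => WithLp.toLp 2 (fun i => g i j)
  let b := InnerProductSpace.gramSchmidtOrthonormalBasis (𝕜 := ℝ) (by simp) f
  refine ⟨Matrix.of fun i j => b j i, ?_, fun i j hij => ?_⟩
  · ext i j
    have := orthonormal_iff_ite.mp b.orthonormal i j
    rw [PiLp.inner_apply] at this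
    simpa [Matrix.mul_apply, Matrix.one_apply, mul_comm] using this
  · have := InnerProductSpace.gramSchmidtOrthonormalBasis_inv_triangular (𝕜 := ℝ)
      (by simp) f hij
    rw [PiLp.inner_apply] at this
    simpa [Matrix.mul_apply, mul_comm, f, b] using this

theorem exists_sorted_diag {A : Matrix (Fin m) (Fin m) ℝ} (hA : Aᵀ = A) :
    ∃ (U : Matrix (Fin m) (Fin m) ℝ) (a : Fin m → ℝ), Uᵀ * U = 1 ∧ Antitone a ∧
      Uᵀ * A * U = Matrix.diagonal a := by
  have hH : A.IsHermitian := by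
    rw [Matrix.IsHermitian, Matrix.conjTranspose_eq_transpose_of_trivial, hA]
  let W : Matrix (Fin m) (Fin m) ℝ := hH.eigenvectorUnitary
  have hW : Wᵀ * W = 1 := by
    have := Unitary.coe_star_mul_self hH.eigenvectorUnitary
    rwa [Matrix.star_eq_conjTranspose, Matrix.conjTranspose_eq_transpose_of_trivial] at this
  have hs : A = W * Matrix.diagonal hH.eigenvalues * Wᵀ := by
    have := hH.spectral_theorem
    rw [Unitary.conjStarAlgAut_apply, Matrix.star_eq_conjTranspose,
      Matrix.conjTranspose_eq_transpose_of_trivial] at this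
    exact this
  have hd : Wᵀ * A * W = Matrix.diagonal hH.eigenvalues := by
    have hs' : Wᵀ * A * W = Wᵀ * (W * Matrix.diagonal hH.eigenvalues * Wᵀ) * W :=
      congrArg (fun M => Wᵀ * M * W) hs
    rw [hs']
    simp only [Matrix.mul_assoc]
    rw [hW, Matrix.mul_one, ← Matrix.mul_assoc, hW, Matrix.one_mul]
  let σ := Tuple.sort (fun i => - hH.eigenvalues i)
  refine ⟨W.submatrix id σ, hH.eigenvalues ∘ σ, ?_, ?_, ?_⟩
  · have := congrArg (fun M => M.submatrix σ σ) hW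
    simpa [Matrix.submatrix_mul_equiv, Matrix.transpose_submatrix,
      Matrix.submatrix_mul _ _ σ id σ Function.bijective_id] using this
  · intro i j hij
    have := Tuple.monotone_sort (fun i => - hH.eigenvalues i) hij
    simpa using this
  · have := congrArg (fun M => M.submatrix σ σ) hd
    simp only [Matrix.submatrix_mul _ _ σ id σ Function.bijective_id, Matrix.submatrix_mul _ _ σ id id Function.bijective_id] at this
    simpa [Matrix.transpose_submatrix] using this

theorem derivation_iff_coord {μ : Bil m} (h : IsSkewBil μ) (d : Fin m → ℝ) :
    IsDerivation μ (Matrix.diagonal d) ↔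
      ∀ i j k, (d k - d i - d j) * μ (bvec m i) (bvec m j) k = 0 := by
  have hb : ∀ i, (Matrix.diagonal d).mulVec (bvec m i) = d i • bvec m i := by
    intro i
    ext k
    rw [mulVec_bvec]
    by_cases hik : k = i
    · subst hik; simp [bvec]
    · simp [bvec, hik]
  constructor
  · intro hD i j k
    have := congrFun (hD (bvec m i) (bvec m j)) k
    rw [hb, hb, (h.1 _).map_smul, (h.2.1 _).map_smul, Matrix.mulVec_diagonal] at this
    simp only [Pi.add_apply, Pi.smul_apply, smul_eq_mul] at this
    linarith
  · intro hc X Y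
    ext k
    rw [Matrix.mulVec_diagonal, Pi.add_apply, bil_expand h X Y,
      bil_expand h (Matrix.mulVec _ X) Y, bil_expand h X]
    simp only [Finset.sum_apply, Pi.smul_apply, smul_eq_mul, Matrix.mulVec_diagonal,
      Finset.mul_sum, ← Finset.sum_add_distrib]
    refine Finset.sum_congr rfl fun i _ => Finset.sum_congr rfl fun j _ => ?_
    linear_combination (X i * Y j) * hc i j k

theorem exp_coord {μ : Bil m} (h : IsSkewBil μ) (a : Fin m → ℝ) (t : ℝ) (i j k : Fin m) :
    mact (Matrix.diagonal fun i => Real.exp (t * a i)) μ (bvec m i) (bvec m j) k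
      = Real.exp (t * (a k - a i - a j)) * μ (bvec m i) (bvec m j) k := by
  have hinv : (Matrix.diagonal fun i => Real.exp (t * a i))⁻¹
      = Matrix.diagonal fun i => Real.exp (-(t * a i)) := by
    apply Matrix.inv_eq_left_inv
    rw [Matrix.diagonal_mul_diagonal, ← Matrix.diagonal_one]
    congr 1
    funext i
    rw [← Real.exp_add]
    simp
  rw [mact_coord h, hinv, Finset.sum_eq_single k, Finset.sum_eq_single i, Finset.sum_eq_single j]
  · simp only [Matrix.diagonal_apply_eq]
    rw [← mul_assoc, ← Real.exp_add, ← Real.exp_add]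
    congr 2
    ring
  · intro r _ hr
    simp [hr]
  · simp
  · intro q _ hq
    simp [hq]
  · simp
  · intro p _ hp
    simp [hp.symm]
  · simp

theorem isUnit_expdiag (a : Fin m → ℝ) (t : ℝ) :
    IsUnit (Matrix.diagonal fun i => Real.exp (t * a i)) := by
  rw [Matrix.isUnit_iff_isUnit_det, Matrix.det_diagonal]
  exact (Finset.prod_pos fun i _ => Real.exp_pos _).ne'.isUnit

theorem diag_comm_iff (a : Fin m → ℝ) (J : Matrix (Fin m) (Fin m) ℝ) :
    Matrix.diagonal a * J = J * Matrix.diagonal a ↔ ∀ i j, a i * J i j = J i j * a j := by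
  constructor
  · intro h i j
    simpa using congrFun (congrFun h i) j
  · intro h
    ext i j
    simpa using h i j

set_option maxHeartbeats 1000000 in
theorem diag_forward {J : Matrix (Fin m) (Fin m) ℝ} (hJskew : Jᵀ = -J) (hJsq : J * J = -1)
    {μ : Bil m} (h : IsSkewBil μ) (h0 : μ ≠ 0) (a : Fin m → ℝ)
    (ha : Ricc J μ = Matrix.diagonal a)
    (hmin : ∀ g : Matrix (Fin m) (Fin m) ℝ, IsCxMat J g →
        Matrix.trace (Ricc J μ * Ricc J μ) / (normSqV μ) ^ 2
          ≤ Matrix.trace (Ricc J (mact g μ) * Ricc J (mact g μ)) / (normSqV (mact g μ)) ^ 2) :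
    ∃ (c : ℝ) (D : Matrix (Fin m) (Fin m) ℝ),
          IsDerivation μ D ∧ Ricc J μ = c • (1 : Matrix (Fin m) (Fin m) ℝ) + D := by
  have hcomm : Matrix.diagonal a * J = J * Matrix.diagonal a := by
    rw [← ha]; exact Ricc_comm μ hJsq
  have hJa := (diag_comm_iff a J).mp hcomm
  let E : ℝ → Matrix (Fin m) (Fin m) ℝ := fun t => Matrix.diagonal fun i => Real.exp (t * a i)
  have hE : ∀ t, IsCxMat J (E t) := by
    intro t
    refine ⟨isUnit_expdiag a t, ?_⟩
    rw [diag_comm_iff]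
    intro i j
    by_cases hz : J i j = 0
    · simp [hz]
    · have : a i = a j := by
        have := hJa i j
        rw [mul_comm] at this
        exact mul_left_cancel₀ hz this
      rw [this, mul_comm]
  have hE0 : mact (E 0) μ = μ := by
    have : E 0 = 1 := by simp [E]
    rw [this, mact_one]
  let T : Fin m → Fin m → Fin m → ℝ := fun i j k => μ (bvec m i) (bvec m j) k
  let w : Fin m → Fin m → Fin m → ℝ := fun i j k => a k - a i - a j
  let S0 := ∑ i, ∑ j, ∑ k, (T i j k) ^ 2
  let S1 := ∑ i, ∑ j, ∑ k, w i j k * (T i j k) ^ 2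
  let S2 := ∑ i, ∑ j, ∑ k, w i j k ^ 2 * (T i j k) ^ 2
  have hS0 : normSqV μ = S0 := rfl
  have hS0pos : 0 < S0 := hS0 ▸ normSqV_pos h h0
  have hcoord : ∀ t i j k, mact (E t) μ (bvec m i) (bvec m j) k
      = Real.exp (t * w i j k) * T i j k := fun t i j k => exp_coord h a t i j k
  have hexp : ∀ c : ℝ, HasDerivAt (fun t : ℝ => Real.exp (t * c)) c 0 := by
    intro c
    have := ((hasDerivAt_id (0:ℝ)).mul_const c).exp
    simpa using this
  have hN : HasDerivAt (fun t => normSqV (mact (E t) μ)) (2 * S1) 0 := by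
    simp only [normSqV, hcoord, S1, Finset.mul_sum]
    refine HasDerivAt.fun_sum fun i _ => HasDerivAt.fun_sum fun j _ =>
      HasDerivAt.fun_sum fun k _ => ?_
    have := (((hexp (w i j k)).mul_const (T i j k)).fun_pow 2)
    refine this.congr_deriv ?_
    simp
    ring
  let H : ℝ → ℝ := fun t => Matrix.trace (Ricc J (mact (E t) μ) * Matrix.diagonal a)
  have hHeq : ∀ t, H t = 1/4 * ∑ i, ∑ j, ∑ k, w i j k * (Real.exp (t * w i j k) * T i j k) ^ 2 := by
    intro t
    simp only [H]
    rw [trace_Ricc_mul _ hJsq hcomm, trace_RicM_diag (mact_skew h _)]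
    simp only [hcoord]
    rfl
  have hH : HasDerivAt H (1/2 * S2) 0 := by
    have e : H = fun t => 1/4 * ∑ i, ∑ j, ∑ k, w i j k * (Real.exp (t * w i j k) * T i j k) ^ 2 :=
      funext hHeq
    rw [e]
    have e2 : 1/2 * S2 = 1/4 * ∑ i, ∑ j, ∑ k, 2 * (w i j k ^ 2 * (T i j k) ^ 2) := by
      simp only [← Finset.mul_sum]
      simp only [S2]
      ring
    rw [e2]
    refine HasDerivAt.const_mul _ (HasDerivAt.fun_sum fun i _ => HasDerivAt.fun_sum fun j _ =>
      HasDerivAt.fun_sum fun k _ => ?_)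
    have := (((hexp (w i j k)).mul_const (T i j k)).fun_pow 2).const_mul (w i j k)
    refine this.congr_deriv ?_
    simp
    ring
  let R : ℝ → Fin m × Fin m → ℝ := fun t p => Ricc J (mact (E t) μ) p.1 p.2
  have hRic : ∀ x y, DifferentiableAt ℝ (fun t => RicM (mact (E t) μ) x y) 0 := by
    intro x y
    simp only [RicM, Matrix.of_apply, hcoord]
    fun_prop
  have hR : ∀ p, DifferentiableAt ℝ (fun t => R t p) 0 := by
    intro p
    simp only [R, Ricc, Matrix.smul_apply, Matrix.sub_apply, Matrix.mul_apply, smul_eq_mul]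
    fun_prop
  let d : Fin m × Fin m → ℝ := fun p => deriv (fun t => R t p) 0
  have hRd : ∀ p, HasDerivAt (fun t => R t p) (d p) 0 := fun p => (hR p).hasDerivAt
  have hR0 : ∀ p : Fin m × Fin m, R 0 p = Matrix.diagonal a p.1 p.2 := by
    intro p
    simp only [R, hE0, ha]
  have hdsymm : (Matrix.diagonal a)ᵀ = Matrix.diagonal a := Matrix.diagonal_transpose a
  have hH2 : HasDerivAt H (∑ p : Fin m × Fin m, d p * Matrix.diagonal a p.1 p.2) 0 := by
    have : H = fun t => ∑ p : Fin m × Fin m, R t p * Matrix.diagonal a p.1 p.2 := by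
      funext t
      exact trace_mul_eq_sum hdsymm
    rw [this]
    exact HasDerivAt.fun_sum fun p _ => (hRd p).mul_const _
  let F : ℝ → ℝ := fun t => Matrix.trace (Ricc J (mact (E t) μ) * Ricc J (mact (E t) μ))
  have hF : HasDerivAt F S2 0 := by
    have e : F = fun t => ∑ p : Fin m × Fin m, R t p * R t p := by
      funext t
      exact trace_mul_eq_sum (Ricc_symm _ hJskew)
    have e2 : S2 = ∑ p : Fin m × Fin m, (d p * R 0 p + R 0 p * d p) := by
      have := hH.unique hH2
      have e3 : S2 = 2 * ∑ p : Fin m × Fin m, d p * Matrix.diagonal a p.1 p.2 := by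
        rw [← this]; ring
      rw [e3, Finset.mul_sum]
      refine Finset.sum_congr rfl fun p _ => ?_
      rw [hR0]; ring
    rw [e, e2]
    exact HasDerivAt.fun_sum fun p _ => (hRd p).mul (hRd p)
  have hF0 : F 0 = 1/4 * S1 := by
    have : F 0 = H 0 := by simp only [F, H, hE0, ha]
    rw [this, hHeq]
    simp [S1]
  let G : ℝ → ℝ := fun t => F t * S0 ^ 2 - F 0 * (normSqV (mact (E t) μ)) ^ 2
  have hN0 : normSqV (mact (E 0) μ) = S0 := by rw [hE0, hS0]
  have hG : HasDerivAt G (S2 * S0 ^ 2 - F 0 * (2 * S0 * (2 * S1))) 0 := by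
    have := (hF.mul_const (S0 ^ 2)).fun_sub ((hN.fun_pow 2).const_mul (F 0))
    refine this.congr_deriv ?_
    simp only [hN0]
    simp
  have hGmin : IsLocalMin G 0 := by
    refine Filter.Eventually.of_forall fun t => ?_
    have h1 := hmin (E t) (hE t)
    have hpos : 0 < normSqV (mact (E t) μ) :=
      normSqV_pos (mact_skew h _) (mact_ne_zero h0 (hE t).1)
    rw [hS0, div_le_div_iff₀ (pow_pos hS0pos 2) (pow_pos hpos 2)] at h1
    have hFμ : Matrix.trace (Ricc J μ * Ricc J μ) = F 0 := by simp only [F, hE0]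
    rw [hFμ] at h1
    have hG0 : G 0 = 0 := by simp only [G, hN0]; ring
    rw [hG0]
    simp only [G]
    linarith
  have hcrit := hGmin.hasDerivAt_eq_zero hG
  rw [hF0] at hcrit
  have hS : S2 * S0 = S1 ^ 2 := by
    have : S0 * (S2 * S0 - S1 ^ 2) = 0 := by linarith
    rcases mul_eq_zero.mp this with h' | h'
    · exact absurd h' hS0pos.ne'
    · linarith
  have hzero : ∑ i, ∑ j, ∑ k, ((w i j k * S0 - S1) * T i j k) ^ 2 = 0 := by
    have : ∑ i, ∑ j, ∑ k, ((w i j k * S0 - S1) * T i j k) ^ 2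
        = S0 ^ 2 * S2 - 2 * S0 * S1 * S1 + S1 ^ 2 * S0 := by
      have e : ∀ i j k, ((w i j k * S0 - S1) * T i j k) ^ 2 = S0 ^ 2 * (w i j k ^ 2 * T i j k ^ 2)
        - 2 * S0 * S1 * (w i j k * T i j k ^ 2) + S1 ^ 2 * T i j k ^ 2 := by
        intro i j k; ring
      simp only [e, Finset.sum_add_distrib, Finset.sum_sub_distrib, ← Finset.mul_sum]
      rfl
    rw [this]
    linear_combination S0 * hS
  have hpt : ∀ i j k, (w i j k * S0 - S1) * T i j k = 0 := by
    intro i j k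
    have h1 := (Finset.sum_eq_zero_iff_of_nonneg (fun i _ => by positivity)).mp hzero i
      (Finset.mem_univ _)
    have h2 := (Finset.sum_eq_zero_iff_of_nonneg (fun i _ => by positivity)).mp h1 j
      (Finset.mem_univ _)
    have h3 := (Finset.sum_eq_zero_iff_of_nonneg (fun i _ => by positivity)).mp h2 k
      (Finset.mem_univ _)
    exact pow_eq_zero_iff (two_ne_zero) |>.mp h3
  refine ⟨-(S1 / S0), Matrix.diagonal fun i => a i + S1 / S0, ?_, ?_⟩
  · rw [derivation_iff_coord h]
    intro i j k
    have := hpt i j k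
    have hne := hS0pos.ne'
    simp only [w, T] at this
    have e : a k + S1 / S0 - (a i + S1 / S0) - (a j + S1 / S0)
        = ((a k - a i - a j) * S0 - S1) / S0 := by
      field_simp
      ring
    rw [e, div_mul_eq_mul_div, this, zero_div]
  · rw [ha]
    ext i j
    by_cases hij : i = j
    · subst hij; simp
    · simp [hij]

theorem diag_backward {J : Matrix (Fin m) (Fin m) ℝ} (hJskew : Jᵀ = -J) (hJsq : J * J = -1)
    {μ : Bil m} (h : IsSkewBil μ) (h0 : μ ≠ 0) (a : Fin m → ℝ) (hanti : Antitone a)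
    (ha : Ricc J μ = Matrix.diagonal a)
    (c : ℝ) (D : Matrix (Fin m) (Fin m) ℝ)
    (hD : IsDerivation μ D) (hDc : Ricc J μ = c • (1 : Matrix (Fin m) (Fin m) ℝ) + D)
    (g : Matrix (Fin m) (Fin m) ℝ) (hg : IsCxMat J g) :
        Matrix.trace (Ricc J μ * Ricc J μ) / (normSqV μ) ^ 2
          ≤ Matrix.trace (Ricc J (mact g μ) * Ricc J (mact g μ)) / (normSqV (mact g μ)) ^ 2 := by
  have hcomm : Matrix.diagonal a * J = J * Matrix.diagonal a := by
    rw [← ha]; exact Ricc_comm μ hJsq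
  have hJa := (diag_comm_iff a J).mp hcomm
  have hDdiag : D = Matrix.diagonal fun i => a i - c := by
    have : D = Matrix.diagonal a - c • (1 : Matrix (Fin m) (Fin m) ℝ) := by
      rw [← ha, hDc]; abel
    rw [this]
    ext i j
    by_cases hij : i = j
    · subst hij; simp
    · simp [hij]
  rw [hDdiag, derivation_iff_coord h] at hD
  have hT : ∀ i j k, μ (bvec m i) (bvec m j) k ≠ 0 → a k = a i + a j - c := by
    intro i j k hne
    have := (mul_eq_zero.mp (hD i j k)).resolve_right hne
    linarith
  obtain ⟨Q, hQ, hQg⟩ := exists_qr g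
  have hQ' : Q * Qᵀ = 1 := mul_eq_one_comm.mp hQ
  have hQu : IsUnit Qᵀ := IsUnit.of_mul_eq_one _ hQ
  have hQt : Qᵀᵀ * Qᵀ = 1 := by rw [Matrix.transpose_transpose, hQ']
  set R := Qᵀ * g with hRdef
  have hRu : IsUnit R := hQu.mul hg.1
  have hRd : IsUnit R.det := (Matrix.isUnit_iff_isUnit_det R).mp hRu
  have hRb : Matrix.BlockTriangular R (fun i => - a i) := by
    intro i j hij
    apply hQg
    by_contra hle
    have := hanti (not_lt.mp hle)
    simp only at hij
    linarith
  have hRib : Matrix.BlockTriangular R⁻¹ (fun i => - a i) := by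
    have := hRu.invertible
    exact Matrix.blockTriangular_inv_of_blockTriangular hRb
  have hgQ : g = Q * R := by rw [hRdef, ← Matrix.mul_assoc, hQ', Matrix.one_mul]
  set B := Q * Matrix.diagonal a * Qᵀ with hB
  have hBs : Bᵀ = B := by
    rw [hB]; simp [Matrix.transpose_mul, Matrix.mul_assoc]
  have hBB : Matrix.trace (B * B) = Matrix.trace (Matrix.diagonal a * Matrix.diagonal a) := by
    have : B * B = Q * (Matrix.diagonal a * Matrix.diagonal a) * Qᵀ := by
      rw [hB]
      simp only [Matrix.mul_assoc]
      rw [← Matrix.mul_assoc Qᵀ Q, hQ, Matrix.one_mul]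
    rw [this, Matrix.trace_mul_comm, ← Matrix.mul_assoc, hQ, Matrix.one_mul]
  set J' := Qᵀ * J * Q with hJ'
  have hJ'eq : J' = R * J * R⁻¹ := by
    have : J' * R = R * J := by
      rw [hJ', Matrix.mul_assoc, ← hgQ, hRdef, Matrix.mul_assoc, Matrix.mul_assoc, hg.2]
    rw [← this, Matrix.mul_assoc, Matrix.mul_nonsing_inv _ hRd, Matrix.mul_one]
  have hJb : Matrix.BlockTriangular J (fun i => - a i) := by
    intro i j hij
    by_contra hne
    have := hJa i j
    rw [mul_comm] at this
    have := mul_left_cancel₀ hne this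
    simp only at hij
    linarith
  have hJ'b : Matrix.BlockTriangular J' (fun i => - a i) := by
    rw [hJ'eq]; exact (hRb.mul hJb).mul hRib
  have hJ's : J'ᵀ = -J' := by
    rw [hJ']; simp [Matrix.transpose_mul, hJskew, Matrix.mul_assoc]
  have hJ'comm : Matrix.diagonal a * J' = J' * Matrix.diagonal a := by
    rw [diag_comm_iff]
    intro i j
    rcases lt_trichotomy (a i) (a j) with hl | he | hl
    · rw [hJ'b (by simpa using hl)]; simp
    · rw [he, mul_comm]
    · have h1 : J' j i = 0 := hJ'b (by simpa using hl)
      have h2 := congrFun (congrFun hJ's j) i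
      simp only [Matrix.transpose_apply, Matrix.neg_apply] at h2
      rw [h2, h1]; simp
  have hBJ : B * J = J * B := by
    have hJQ : J = Q * J' * Qᵀ := by
      rw [hJ']
      simp only [Matrix.mul_assoc]
      rw [hQ', Matrix.mul_one, ← Matrix.mul_assoc, hQ', Matrix.one_mul]
    have e1 : B * J = Q * (Matrix.diagonal a * J') * Qᵀ := by
      rw [hB, hJQ]
      simp only [Matrix.mul_assoc]
      rw [← Matrix.mul_assoc Qᵀ Q, hQ, Matrix.one_mul]
    have e2 : J * B = Q * (J' * Matrix.diagonal a) * Qᵀ := by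
      rw [hB, hJQ]
      simp only [Matrix.mul_assoc]
      rw [← Matrix.mul_assoc Qᵀ Q, hQ, Matrix.one_mul]
    rw [e1, e2, hJ'comm]
  have hact : mact R μ = mact Qᵀ (mact g μ) := by rw [hRdef, mact_mul]
  have hRic : RicM (mact R μ) = Qᵀ * RicM (mact g μ) * Q := by
    rw [hact, RicM_mact (mact_skew h g) hQt, Matrix.transpose_transpose]
  have hnorm : normSqV (mact R μ) = normSqV (mact g μ) := by
    rw [hact, normSqV_mact (mact_skew h g) hQt]
  have hsupp : ∀ i j k, mact R μ (bvec m i) (bvec m j) k ≠ 0 → a i + a j - c ≤ a k := by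
    intro i j k hne
    rw [mact_coord h] at hne
    obtain ⟨p, -, hp⟩ := Finset.exists_ne_zero_of_sum_ne_zero hne
    obtain ⟨q, -, hq⟩ := Finset.exists_ne_zero_of_sum_ne_zero hp
    obtain ⟨r, -, hr⟩ := Finset.exists_ne_zero_of_sum_ne_zero hq
    have h1 := left_ne_zero_of_mul hr
    have h2 := right_ne_zero_of_mul hr
    have h3 := right_ne_zero_of_mul h2
    have h4 := left_ne_zero_of_mul h2
    have h5 := left_ne_zero_of_mul h4
    have h6 := right_ne_zero_of_mul h4
    have k1 : a p ≤ a k := by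
      by_contra hlt; exact h1 (hRb (by simpa using hlt))
    have k2 : a i ≤ a q := by
      by_contra hlt; exact h5 (hRib (by simpa using hlt))
    have k3 : a j ≤ a r := by
      by_contra hlt; exact h6 (hRib (by simpa using hlt))
    have := hT q r p h3
    linarith
  have hest : -c / 4 * normSqV (mact g μ) ≤ Matrix.trace (Ricc J (mact g μ) * B) := by
    have e : Matrix.trace (Ricc J (mact g μ) * B)
        = Matrix.trace (RicM (mact R μ) * Matrix.diagonal a) := by
      rw [trace_Ricc_mul _ hJsq hBJ, hRic, hB]
      simp only [Matrix.mul_assoc]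
      rw [Matrix.trace_mul_comm Qᵀ]
      simp only [Matrix.mul_assoc]
    rw [e, trace_RicM_diag (mact_skew h R), ← hnorm, normSqV]
    have : -c * ∑ i, ∑ j, ∑ k, (mact R μ (bvec m i) (bvec m j) k) ^ 2
      ≤ ∑ i, ∑ j, ∑ k, (a k - a i - a j) * (mact R μ (bvec m i) (bvec m j) k) ^ 2 := by
      simp only [Finset.mul_sum]
      refine Finset.sum_le_sum fun i _ => Finset.sum_le_sum fun j _ =>
        Finset.sum_le_sum fun k _ => ?_
      by_cases hz : mact R μ (bvec m i) (bvec m j) k = 0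
      · simp [hz]
      · have := hsupp i j k hz
        exact mul_le_mul_of_nonneg_right (by linarith) (sq_nonneg _)
    linarith
  have hself : Matrix.trace (Ricc J μ * Ricc J μ) = -c / 4 * normSqV μ := by
    have e : Matrix.trace (Ricc J μ * Ricc J μ) = Matrix.trace (RicM μ * Matrix.diagonal a) := by
      rw [← trace_Ricc_mul μ hJsq hcomm, ← ha]
    rw [e, trace_RicM_diag h, normSqV]
    have : ∑ i, ∑ j, ∑ k, (a k - a i - a j) * (μ (bvec m i) (bvec m j) k) ^ 2
      = -c * ∑ i, ∑ j, ∑ k, (μ (bvec m i) (bvec m j) k) ^ 2 := by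
      simp only [Finset.mul_sum]
      refine Finset.sum_congr rfl fun i _ => Finset.sum_congr rfl fun j _ =>
        Finset.sum_congr rfl fun k _ => ?_
      have := hD i j k
      linear_combination (μ (bvec m i) (bvec m j) k) * this
    rw [this]; ring
  have hcs := trace_cs (Ricc_symm (mact g μ) hJskew) hBs
  have hBB' : Matrix.trace (B * B) = -c / 4 * normSqV μ := by rw [hBB, ← hself, ha]
  rw [hBB'] at hcs
  have hNpos := normSqV_pos h h0
  have hNgpos := normSqV_pos (mact_skew h g) (mact_ne_zero h0 hg.1)
  have hXnn : 0 ≤ Matrix.trace (Ricc J (mact g μ) * Ricc J (mact g μ)) := by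
    rw [trace_mul_eq_sum (Ricc_symm _ hJskew)]
    exact Finset.sum_nonneg fun p _ => mul_self_nonneg _
  have hselfnn : 0 ≤ Matrix.trace (Ricc J μ * Ricc J μ) := by
    rw [trace_mul_eq_sum (Ricc_symm _ hJskew)]
    exact Finset.sum_nonneg fun p _ => mul_self_nonneg _
  rw [hself] at hselfnn ⊢
  set N := normSqV μ
  set N' := normSqV (mact g μ)
  set X := Matrix.trace (Ricc J (mact g μ) * Ricc J (mact g μ))
  set e := -c / 4
  have he : 0 ≤ e := nonneg_of_mul_nonneg_left hselfnn hNpos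
  rw [div_le_div_iff₀ (by positivity) (by positivity)]
  rcases he.eq_or_lt with he0 | hepos
  · rw [← he0]
    have : 0 ≤ X * N ^ 2 := by positivity
    simpa using this
  · have h1 : (e * N') ^ 2 ≤ X * (e * N) :=
      le_trans (pow_le_pow_left₀ (by positivity) hest 2) hcs
    have h2 : e * N' ^ 2 ≤ X * N := by
      have : e * (e * N' ^ 2) ≤ e * (X * N) := by nlinarith
      exact le_of_mul_le_mul_left this hepos
    nlinarith [mul_le_mul_of_nonneg_right h2 hNpos.le]

end helpers

/-- conjugating an inequality/derivation statement by an orthogonal matrix -/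
theorem derivation_conj {m : ℕ} {μ : Bil m} {g D : Matrix (Fin m) (Fin m) ℝ}
    (hg : IsUnit g) (hD : IsDerivation μ D) : IsDerivation (mact g μ) (g * D * g⁻¹) := by
  have hd : IsUnit g.det := (Matrix.isUnit_iff_isUnit_det g).mp hg
  intro X Y
  simp only [mact, Matrix.mulVec_mulVec]
  have e : g⁻¹ * (g * D * g⁻¹) = D * g⁻¹ := by
    rw [Matrix.mul_assoc, ← Matrix.mul_assoc g⁻¹, Matrix.nonsing_inv_mul _ hd, Matrix.one_mul]
  rw [e, Matrix.mul_assoc (g * D), Matrix.nonsing_inv_mul _ hd, Matrix.mul_one,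
    ← Matrix.mulVec_mulVec, hD, Matrix.mulVec_add, ← Matrix.mulVec_mulVec, ← Matrix.mulVec_mulVec]

/-- a compatible metric on an (almost-)complex nilpotent Lie group is minimal iff
the complexified Ricci operator equals `cI + D` with `D` a derivation. -/
theorem minimal_iff_complex (n : ℕ) (hn : 1 ≤ n)
    (J : Matrix (Fin (2 * n)) (Fin (2 * n)) ℝ) (hJskew : Jᵀ = -J) (hJsq : J * J = -1)
    (μ : Bil (2 * n)) (hμ : NilBracket μ) (hμ0 : μ ≠ 0) :
    (∀ g : Matrix (Fin (2 * n)) (Fin (2 * n)) ℝ, IsCxMat J g →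
        Matrix.trace (Ricc J μ * Ricc J μ) / (normSqV μ) ^ 2
          ≤ Matrix.trace (Ricc J (mact g μ) * Ricc J (mact g μ)) / (normSqV (mact g μ)) ^ 2)
      ↔ ∃ (c : ℝ) (D : Matrix (Fin (2 * n)) (Fin (2 * n)) ℝ),
          IsDerivation μ D ∧ Ricc J μ = c • (1 : Matrix (Fin (2 * n)) (Fin (2 * n)) ℝ) + D := by
  obtain ⟨hs, -, -⟩ := hμ
  obtain ⟨U, a, hU, hanti, hdiag⟩ := exists_sorted_diag (Ricc_symm μ hJskew)
  have hU' : U * Uᵀ = 1 := mul_eq_one_comm.mp hU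
  have hUt : Uᵀᵀ * Uᵀ = 1 := by rw [Matrix.transpose_transpose, hU']
  have hUu : IsUnit U := IsUnit.of_mul_eq_one _ hU'
  have hUtu : IsUnit Uᵀ := IsUnit.of_mul_eq_one _ hU
  have hUi : U⁻¹ = Uᵀ := Matrix.inv_eq_left_inv hU
  have hUti : Uᵀ⁻¹ = U := Matrix.inv_eq_left_inv hU'
  set ν := mact Uᵀ μ with hν
  have hνs : IsSkewBil ν := mact_skew hs _
  have hν0 : ν ≠ 0 := mact_ne_zero hμ0 hUtu
  have hμν : μ = mact U ν := by rw [hν, ← mact_mul, hU', mact_one]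
  set J' := Uᵀ * J * U with hJ'
  have hJ's : J'ᵀ = -J' := by
    rw [hJ']; simp [Matrix.transpose_mul, hJskew, Matrix.mul_assoc]
  have hJ'sq : J' * J' = -1 := by
    have : J' * J' = Uᵀ * (J * J) * U := by
      rw [hJ']
      simp only [Matrix.mul_assoc]
      rw [← Matrix.mul_assoc U Uᵀ, hU', Matrix.one_mul]
    rw [this, hJsq]; simp [hU]
  have hRc : ∀ ρ : Bil (2 * n), IsSkewBil ρ → Ricc J (mact U ρ) = U * Ricc J' ρ * Uᵀ :=
    fun ρ hρ => Ricc_mact hρ J hU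
  have htr : ∀ ρ : Bil (2 * n), IsSkewBil ρ →
      Matrix.trace (Ricc J (mact U ρ) * Ricc J (mact U ρ)) / (normSqV (mact U ρ)) ^ 2
        = Matrix.trace (Ricc J' ρ * Ricc J' ρ) / (normSqV ρ) ^ 2 := by
    intro ρ hρ
    have e : U * Ricc J' ρ * Uᵀ * (U * Ricc J' ρ * Uᵀ) = U * (Ricc J' ρ * Ricc J' ρ) * Uᵀ := by
      simp only [Matrix.mul_assoc]
      rw [← Matrix.mul_assoc Uᵀ U, hU, Matrix.one_mul]
    rw [normSqV_mact hρ hU, hRc ρ hρ, e, Matrix.trace_mul_comm, ← Matrix.mul_assoc, hU,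
      Matrix.one_mul]
  have hRν : Ricc J' ν = Matrix.diagonal a := by
    rw [← hdiag]
    have := hRc ν hνs
    rw [← hμν] at this
    rw [this]
    simp only [Matrix.mul_assoc]
    rw [hU, Matrix.mul_one, ← Matrix.mul_assoc, hU, Matrix.one_mul]
  have hconj : ∀ g : Matrix (Fin (2 * n)) (Fin (2 * n)) ℝ, IsCxMat J g →
      IsCxMat J' (Uᵀ * g * U) := by
    rintro g ⟨hg1, hg2⟩
    refine ⟨(hUtu.mul hg1).mul hUu, ?_⟩
    rw [hJ']
    simp only [Matrix.mul_assoc]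
    rw [← Matrix.mul_assoc U Uᵀ, hU', Matrix.one_mul, ← Matrix.mul_assoc U Uᵀ, hU', Matrix.one_mul,
      ← Matrix.mul_assoc g J, hg2, Matrix.mul_assoc]
  have hconj' : ∀ g : Matrix (Fin (2 * n)) (Fin (2 * n)) ℝ, IsCxMat J' g →
      IsCxMat J (U * g * Uᵀ) := by
    rintro g ⟨hg1, hg2⟩
    refine ⟨(hUu.mul hg1).mul hUtu, ?_⟩
    have hJJ : J = U * J' * Uᵀ := by
      rw [hJ']
      simp only [Matrix.mul_assoc]
      rw [hU', Matrix.mul_one, ← Matrix.mul_assoc, hU', Matrix.one_mul]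
    rw [hJJ]
    simp only [Matrix.mul_assoc]
    rw [← Matrix.mul_assoc Uᵀ U, hU, Matrix.one_mul, ← Matrix.mul_assoc Uᵀ U, hU, Matrix.one_mul,
      ← Matrix.mul_assoc g J', hg2, Matrix.mul_assoc]
  constructor
  · intro hmin
    obtain ⟨c, D, hD, hE⟩ := diag_forward hJ's hJ'sq hνs hν0 a hRν (by
      intro g hg
      have h1 := hmin _ (hconj' g hg)
      have e : mact (U * g * Uᵀ) μ = mact U (mact g ν) := by rw [mact_mul, mact_mul]
      rw [e, htr _ (mact_skew hνs g)] at h1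
      have h2 := htr ν hνs
      rw [← hμν] at h2
      rwa [h2] at h1)
    refine ⟨c, U * D * U⁻¹, ?_, ?_⟩
    · have := derivation_conj hUu hD
      rwa [← hμν] at this
    · have := hRc ν hνs
      rw [← hμν] at this
      rw [this, hE, hUi, Matrix.mul_add, Matrix.add_mul, Matrix.mul_smul, Matrix.mul_one,
        Matrix.smul_mul, hU']
  · rintro ⟨c, D, hD, hE⟩ g hg
    have hD' : IsDerivation ν (Uᵀ * D * U) := by
      have := derivation_conj hUtu hD
      rwa [hUti] at this
    have hE' : Ricc J' ν = c • (1 : Matrix (Fin (2 * n)) (Fin (2 * n)) ℝ) + Uᵀ * D * U := by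
      rw [hRν, ← hdiag, hE, Matrix.mul_add, Matrix.add_mul, Matrix.mul_smul, Matrix.mul_one,
        Matrix.smul_mul, hU]
    have key := diag_backward hJ's hJ'sq hνs hν0 a hanti hRν c _ hD' hE' _ (hconj g hg)
    have e : mact g μ = mact U (mact (Uᵀ * g * U) ν) := by
      rw [← mact_mul, hμν, ← mact_mul]
      congr 1
      simp only [← Matrix.mul_assoc]
      rw [hU', Matrix.one_mul]
    rw [e, htr _ (mact_skew hνs _)]
    have h2 := htr ν hνs
    rw [← hμν] at h2
    rwa [h2]
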